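/- (Corollary 2) Let B_1,…,B_K > 0 and σ_1,…,σ_K > 0. Let f : ℝ^K → ℝ be smooth and satisfy |∂^α f(y)| ≤ (Π_{k=1}^K B_k^{α_k}) · H for every multi-index α and every y ∈ ℝ^K. Let x be a random vector whose k-th coordinate is an independent Gaussian random variable with mean 0 and variance σ_k², and let T_n f be the degree-n Taylor polynomial of f at 0. Then E[ |f(x) − T_n f(x)|² ] < (1/K) Σ_{k=1}^K ((√2 · K · B_k · σ_k)^{n+1} · H)² / (n+1)!. -/

import Mathlib

open MeasureTheory

/-- Single partial derivative in coordinate direction `k`. -/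
noncomputable def pderiv1 {K : ℕ} (k : Fin K) (f : (Fin K → ℝ) → ℝ) : (Fin K → ℝ) → ℝ :=
  fun x => fderiv ℝ f x (Pi.single k 1)

/-- Mixed partial derivative `∂^α f` for a multi-index `α : Fin K → ℕ`. -/
noncomputable def mpderiv {K : ℕ} (α : Fin K → ℕ) (f : (Fin K → ℝ) → ℝ) :
    (Fin K → ℝ) → ℝ :=
  (List.finRange K).foldr (fun k g => (pderiv1 k)^[α k] g) f

/-- Degree-`n` Taylor polynomial of `f` at `0`:
`T_n f(x) = Σ_{|α| ≤ n} (∂^α f(0) / α!) x^α`. -/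
noncomputable def taylorPoly {K : ℕ} (n : ℕ) (f : (Fin K → ℝ) → ℝ) (x : Fin K → ℝ) : ℝ :=
  ∑ β : Fin K → Fin (n + 1), if (∑ k, (β k : ℕ)) ≤ n then
    (mpderiv (fun k => (β k : ℕ)) f 0 / ∏ k, ((β k : ℕ).factorial : ℝ)) *
      ∏ k, x k ^ (β k : ℕ)
  else 0

/-- Smooth functions as a submodule. -/
def SmoothSub (K : ℕ) : Submodule ℝ ((Fin K → ℝ) → ℝ) where
  carrier := {f | ContDiff ℝ (⊤ : ℕ∞) f}
  add_mem' := by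
    intro a b ha hb
    rw [Set.mem_ofPred_eq] at *
    exact ha.add hb
  zero_mem' := by
    rw [Set.mem_ofPred_eq]
    exact contDiff_const
  smul_mem' := by
    intro c f hf
    rw [Set.mem_ofPred_eq] at *
    exact contDiff_const.smul hf

lemma SmoothSub_cd {K : ℕ} (f : SmoothSub K) : ContDiff ℝ (⊤ : ℕ∞) f.1 := f.2

lemma contDiff_pderiv1 {K : ℕ} (k : Fin K) {f : (Fin K → ℝ) → ℝ}
    (hf : ContDiff ℝ (⊤ : ℕ∞) f) : ContDiff ℝ (⊤ : ℕ∞) (pderiv1 k f) := by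
  unfold pderiv1
  exact (hf.fderiv_right (m := (⊤ : ℕ∞)) (by simp)).clm_apply contDiff_const

lemma smooth_diff {K : ℕ} {f : (Fin K → ℝ) → ℝ}
    (hf : ContDiff ℝ (⊤ : ℕ∞) f) : Differentiable ℝ f :=
  hf.differentiable (by simp)

/-- Partial derivative as an endomorphism. -/
noncomputable def DD {K : ℕ} (k : Fin K) : Module.End ℝ (SmoothSub K) where
  toFun f := ⟨pderiv1 k f.1, contDiff_pderiv1 k (SmoothSub_cd f)⟩
  map_add' := fun f g => by
    ext x
    simp only [pderiv1, Submodule.coe_add, Pi.add_apply]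
    rw [fderiv_add (smooth_diff (SmoothSub_cd f) x) (smooth_diff (SmoothSub_cd g) x)]
    rfl
  map_smul' := fun c f => by
    ext x
    simp only [pderiv1, Submodule.coe_smul, RingHom.id_apply, Pi.smul_apply]
    rw [fderiv_const_smul (smooth_diff (SmoothSub_cd f) x)]
    rfl

lemma DD_apply {K : ℕ} (k : Fin K) (f : SmoothSub K) : (DD k f).1 = pderiv1 k f.1 := rfl

lemma DD_comm {K : ℕ} (k l : Fin K) : Commute (DD k) (DD l) := by
  refine LinearMap.ext fun f => ?_
  ext x
  change pderiv1 k (pderiv1 l f.1) x = pderiv1 l (pderiv1 k f.1) x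
  have hd : DifferentiableAt ℝ (fderiv ℝ f.1) x :=
    ((SmoothSub_cd f).fderiv_right (m := (⊤ : ℕ∞)) (by simp)).differentiable (by simp) x
  have key : ∀ v w : Fin K → ℝ, fderiv ℝ (fun y => fderiv ℝ f.1 y v) x w
      = fderiv ℝ (fderiv ℝ f.1) x w v := by
    intro v w
    rw [fderiv_clm_apply hd (differentiableAt_const v)]
    simp
  unfold pderiv1
  rw [key, key]
  have hs : IsSymmSndFDerivAt ℝ f.1 x :=
    ContDiffAt.isSymmSndFDerivAt (n := ((⊤ : ℕ∞) : WithTop ℕ∞))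
      (SmoothSub_cd f).contDiffAt (by simp [minSmoothness_of_isRCLikeNormedField]; exact WithTop.coe_le_coe.2 (le_top : (2 : ℕ∞) ≤ ⊤))
  exact hs _ _

/-- Directional derivative as an endomorphism. -/
noncomputable def DX {K : ℕ} (x : Fin K → ℝ) : Module.End ℝ (SmoothSub K) := ∑ k, x k • DD k

lemma DX_apply {K : ℕ} (x : Fin K → ℝ) (f : SmoothSub K) (y : Fin K → ℝ) :
    (DX x f).1 y = fderiv ℝ f.1 y x := by
  have h : (DX x f).1 y = ∑ k, x k * fderiv ℝ f.1 y (Pi.single k 1) := by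
    simp [DX, LinearMap.sum_apply, DD_apply, pderiv1]
  rw [h]
  conv_rhs => rw [← Finset.univ_sum_single x, map_sum]
  refine Finset.sum_congr rfl fun k _ => ?_
  have : (Pi.single k (x k) : Fin K → ℝ) = x k • Pi.single k 1 := by
    rw [← Pi.single_smul]; simp
  rw [this, map_smul, smul_eq_mul]

lemma list_prod_smul {K : ℕ} (c : Fin K → ℝ) (A : Fin K → Module.End ℝ (SmoothSub K))
    (l : List (Fin K)) :
    (l.map fun k => c k • A k).prod = (l.map c).prod • (l.map A).prod := by
  induction l with
  | nil => simp
  | cons a l ih => simp only [List.map_cons, List.prod_cons, ih, smul_mul_smul_comm]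

lemma list_prod_apply {K : ℕ} (α : Fin K → ℕ) (l : List (Fin K)) (f : SmoothSub K) :
    ((l.map fun k => DD k ^ α k).prod f).1
      = l.foldr (fun k g => (pderiv1 k)^[α k] g) f.1 := by
  induction l with
  | nil => simp
  | cons a l ih =>
    simp only [List.map_cons, List.prod_cons, List.foldr_cons, ← ih, Module.End.mul_apply]
    generalize (List.map (fun k => DD k ^ α k) l).prod f = g
    generalize α a = m
    induction m generalizing g with
    | zero => simp
    | succ m ihm =>
      rw [pow_succ, Module.End.mul_apply, ihm, Function.iterate_succ_apply, DD_apply]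

lemma DX_pow {K : ℕ} (x : Fin K → ℝ) (m : ℕ) (f : SmoothSub K) (y : Fin K → ℝ) :
    ((DX x ^ m) f).1 y = ∑ α ∈ Finset.piAntidiag Finset.univ m,
      (Nat.multinomial Finset.univ α : ℝ) * ((∏ k, x k ^ α k) * mpderiv α f.1 y) := by
  have hc : ((Finset.univ : Finset (Fin K)) : Set (Fin K)).Pairwise
      (Function.onFun Commute fun k => x k • DD k) := by
    intro a _ b _ _
    exact ((DD_comm a b).smul_left _).smul_right _
  have h0 := Finset.sum_pow_eq_sum_piAntidiag_of_commute Finset.univ (fun k => x k • DD k) hc m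
  have h1 : DX x ^ m = _ := h0
  rw [h1]
  simp only [LinearMap.sum_apply, Finset.sum_apply, AddSubmonoidClass.coe_finsetSum]
  refine Finset.sum_congr rfl fun α _ => ?_
  have h2 : Finset.univ.noncommProd (fun k => (x k • DD k) ^ α k)
      (hc.mono' fun _ _ h ↦ h.pow_pow ..) =
      (∏ k, x k ^ α k) • ((List.finRange K).map fun k => DD k ^ α k).prod := by
    have : Finset.univ.noncommProd (fun k => (x k • DD k) ^ α k)
      (hc.mono' fun _ _ h ↦ h.pow_pow ..) = ((List.finRange K).map fun k => (x k • DD k) ^ α k).prod := by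
      exact Multiset.noncommProd_coe _ _
    rw [this]
    simp only [smul_pow]
    rw [list_prod_smul (fun k => x k ^ α k) (fun k => DD k ^ α k)]
    rfl
  rw [h2, ← nsmul_eq_mul, LinearMap.smul_apply, LinearMap.smul_apply,
    AddSubmonoidClass.coe_nsmul, Submodule.coe_smul, list_prod_apply]
  simp [mpderiv, mul_assoc]

lemma iter_line {K : ℕ} (x : Fin K → ℝ) (f : SmoothSub K) (m : ℕ) :
    iteratedDeriv m (fun t : ℝ => f.1 (t • x)) = fun t => ((DX x ^ m) f).1 (t • x) := by
  induction m with
  | zero => simp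
  | succ m ih =>
    rw [iteratedDeriv_succ, ih]
    funext t
    rw [pow_succ', Module.End.mul_apply, DX_apply]
    have h1 : HasFDerivAt ((DX x ^ m) f).1 (fderiv ℝ ((DX x ^ m) f).1 (t • x)) (t • x) :=
      (smooth_diff (SmoothSub_cd ((DX x ^ m) f)) _).hasFDerivAt
    have h2 : HasDerivAt (fun t : ℝ => t • x) x t := by
      simpa using (hasDerivAt_id t).smul_const x
    exact (h1.comp_hasDerivAt t h2).deriv

lemma taylorPoly_eq {K n : ℕ} (f : (Fin K → ℝ) → ℝ) (x : Fin K → ℝ) :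
    taylorPoly n f x = ∑ m ∈ Finset.range (n + 1), ∑ α ∈ Finset.piAntidiag Finset.univ m,
      (mpderiv α f 0 / ∏ k, ((α k).factorial : ℝ)) * ∏ k, x k ^ α k := by
  unfold taylorPoly
  rw [← Finset.sum_filter, Finset.sum_sigma']
  symm
  have hle : ∀ (α : Fin K → ℕ) (k : Fin K), α k ≤ ∑ k, α k := fun α k =>
    Finset.single_le_sum (f := α) (fun _ _ => Nat.zero_le _) (Finset.mem_univ k)
  refine Finset.sum_bij' (fun p _ => fun k => Fin.ofNat (n + 1) (p.2 k))
    (fun β _ => ⟨∑ k, (β k : ℕ), fun k => (β k : ℕ)⟩) ?_ ?_ ?_ ?_ ?_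
  · rintro ⟨m, α⟩ h
    simp only [Finset.mem_sigma, Finset.mem_range, Finset.mem_piAntidiag] at h
    obtain ⟨hm, h1, -⟩ := h
    change ∑ k, α k = m at h1
    simp only [Finset.mem_filter, Finset.mem_univ, true_and, Fin.val_ofNat]
    have : ∀ k, α k % (n + 1) = α k := fun k => Nat.mod_eq_of_lt (by have := hle α k; omega)
    simp only [this]; omega
  · intro β h
    simp only [Finset.mem_filter, Finset.mem_univ, true_and] at h
    simp only [Finset.mem_sigma, Finset.mem_range, Finset.mem_piAntidiag]
    refine ⟨by omega, ?_⟩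
    simp
  · rintro ⟨m, α⟩ h
    simp only [Finset.mem_sigma, Finset.mem_range, Finset.mem_piAntidiag] at h
    obtain ⟨hm, h1, -⟩ := h
    change ∑ k, α k = m at h1
    have : ∀ k, α k % (n + 1) = α k := fun k => Nat.mod_eq_of_lt (by have := hle α k; omega)
    simp only [Fin.val_ofNat, this, h1]
  · intro β h
    funext k
    apply Fin.ext
    simp [Nat.mod_eq_of_lt (β k).2]
  · rintro ⟨m, α⟩ h
    simp only [Finset.mem_sigma, Finset.mem_range, Finset.mem_piAntidiag] at h
    obtain ⟨hm, h1, -⟩ := h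
    change ∑ k, α k = m at h1
    have : ∀ k, α k % (n + 1) = α k := fun k => Nat.mod_eq_of_lt (by have := hle α k; omega)
    simp only [Fin.val_ofNat, this]

lemma pointwise_bound {K n : ℕ} (f : (Fin K → ℝ) → ℝ) (B : Fin K → ℝ) (H : ℝ)
    (hf : ContDiff ℝ (⊤ : ℕ∞) f)
    (hBern : ∀ (α : Fin K → ℕ) (y : Fin K → ℝ),
      |mpderiv α f y| ≤ (∏ k, B k ^ α k) * H) (x : Fin K → ℝ) :
    |f x - taylorPoly n f x| ≤ (∑ k, B k * |x k|) ^ (n + 1) * H / (n + 1).factorial := by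
  let F : SmoothSub K := ⟨f, hf⟩
  have hg : ContDiff ℝ (⊤ : ℕ∞) (fun t : ℝ => F.1 (t • x)) :=
    (SmoothSub_cd F).comp (contDiff_id.smul contDiff_const)
  obtain ⟨ξ, -, hξ⟩ := taylor_mean_remainder_lagrange_iteratedDeriv (f := fun t : ℝ => F.1 (t • x))
    (x₀ := 0) (x := 1) (n := n) zero_ne_one ((hg.of_le (by norm_cast; exact le_top)).contDiffOn)
  have hT : taylorWithinEval (fun t : ℝ => F.1 (t • x)) n (Set.uIcc 0 1) 0 1 = taylorPoly n f x := by
    rw [taylor_within_apply, taylorPoly_eq]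
    refine Finset.sum_congr rfl fun m _ => ?_
    rw [iteratedDerivWithin_eq_iteratedDeriv (uniqueDiffOn_uIcc zero_ne_one)
      (hg.of_le (by norm_cast; exact le_top)).contDiffAt (by simp), iter_line]
    simp only [zero_smul, DX_pow, sub_zero, one_pow, mul_one, smul_eq_mul, Finset.mul_sum]
    refine Finset.sum_congr rfl fun α hα => ?_
    rw [Finset.mem_piAntidiag] at hα
    have hsp := Nat.multinomial_spec (Finset.univ : Finset (Fin K)) α
    rw [hα.1] at hsp
    have hsp' : (∏ k, ((α k).factorial : ℝ)) * (Nat.multinomial Finset.univ α : ℝ) = m.factorial := by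
      exact_mod_cast hsp
    have h0 : (∏ k, ((α k).factorial : ℝ)) ≠ 0 :=
      Finset.prod_ne_zero_iff.2 fun k _ => by exact_mod_cast Nat.factorial_ne_zero _
    have h1 : (m.factorial : ℝ) ≠ 0 := by exact_mod_cast Nat.factorial_ne_zero _
    change _ = mpderiv α F.1 0 / _ * _
    rw [← hsp'] at h1 ⊢
    have h2 : (Nat.multinomial Finset.univ α : ℝ) ≠ 0 := right_ne_zero_of_mul h1
    field_simp
  rw [hT, iter_line] at hξ
  simp only [one_smul, sub_zero, one_pow, mul_one] at hξ
  change f x - _ = _ at hξ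
  rw [hξ, abs_div, Nat.abs_cast]
  gcongr
  rw [DX_pow, Finset.sum_pow_eq_sum_piAntidiag, Finset.sum_mul]
  refine (Finset.abs_sum_le_sum_abs _ _).trans (Finset.sum_le_sum fun α _ => ?_)
  rw [abs_mul, Nat.abs_cast, mul_assoc]
  gcongr
  rw [abs_mul, Finset.abs_prod]
  simp only [abs_pow, mul_pow, Finset.prod_mul_distrib]
  calc _ ≤ (∏ k, |x k| ^ α k) * ((∏ k, B k ^ α k) * H) := by
        gcongr; exact hBern α _
    _ = _ := by ring

lemma gauss_moment (s : ℝ) (hs : 0 < s) (v : NNReal) (hvs : (v : ℝ) = s ^ 2) (n : ℕ) :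
    ∫ x, x ^ (2 * (n + 1)) ∂(ProbabilityTheory.gaussianReal 0 v)
      = s ^ (2 * (n + 1)) * (Nat.doubleFactorial (2 * n + 1) : ℝ) := by
  have hv : v ≠ 0 := by
    rintro rfl
    rw [NNReal.coe_zero] at hvs
    have : 0 < s ^ 2 := by positivity
    linarith
  rw [ProbabilityTheory.integral_gaussianReal_eq_integral_smul hv]
  simp only [ProbabilityTheory.gaussianPDFReal, sub_zero, smul_eq_mul, hvs]
  have h1 : ∀ x : ℝ, (√(2 * Real.pi * s ^ 2))⁻¹ * Real.exp (-x ^ 2 / (2 * s ^ 2)) * x ^ (2 * (n + 1))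
      = (fun y : ℝ => (√(2 * Real.pi * s ^ 2))⁻¹ *
        (y ^ ((2 * (n + 1) : ℕ) : ℝ) * Real.exp (-(1 / (2 * s ^ 2)) * y ^ (2 : ℝ)))) |x| := by
    intro x
    simp only [Real.rpow_natCast]
    have : |x| ^ (2 : ℝ) = x ^ 2 := by
      rw [show (2 : ℝ) = ((2 : ℕ) : ℝ) by norm_num, Real.rpow_natCast, sq_abs]
    rw [this, pow_mul, pow_mul, sq_abs]
    rw [show -(1 / (2 * s ^ 2)) * x ^ 2 = -x ^ 2 / (2 * s ^ 2) by ring]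
    ring
  have hpi := Real.pi_pos
  simp only [h1]
  rw [integral_comp_abs (f := fun y : ℝ => (√(2 * Real.pi * s ^ 2))⁻¹ *
        (y ^ ((2 * (n + 1) : ℕ) : ℝ) * Real.exp (-(1 / (2 * s ^ 2)) * y ^ (2 : ℝ)))),
    integral_const_mul, integral_rpow_mul_exp_neg_mul_rpow (by norm_num)
      (lt_of_lt_of_le (by norm_num) (Nat.cast_nonneg _)) (by positivity)]
  have e1 : (((2 * (n + 1) : ℕ) : ℝ) + 1) / 2 = n + 1 + 1 / 2 := by push_cast; ring
  rw [e1, Real.Gamma_nat_add_one_add_half]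
  have e2 : (1 / (2 * s ^ 2)) ^ (-(((2 * (n + 1) : ℕ) : ℝ) + 1) / 2)
      = (2 * s ^ 2) ^ (n + 1) * √(2 * s ^ 2) := by
    rw [neg_div, e1, one_div, Real.inv_rpow (by positivity), Real.rpow_neg (by positivity), inv_inv,
      Real.rpow_add (by positivity), Real.sqrt_eq_rpow]
    congr 1
    exact_mod_cast Real.rpow_natCast _ (n + 1)
  rw [e2, show 2 * Real.pi * s ^ 2 = (2 * s ^ 2) * Real.pi by ring, Real.sqrt_mul (by positivity)]
  have a1 : √(2 * s ^ 2) ≠ 0 := (Real.sqrt_pos.2 (by positivity)).ne'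
  have a2 : √Real.pi ≠ 0 := (Real.sqrt_pos.2 hpi).ne'
  field_simp
  ring

lemma gauss_int (v : NNReal) (n : ℕ) :
    Integrable (fun x : ℝ => x ^ (2 * (n + 1))) (ProbabilityTheory.gaussianReal 0 v) := by
  have h := (ProbabilityTheory.memLp_id_gaussianReal (μ := 0) (v := v) ((2 * (n + 1) : ℕ) : NNReal))
  have h2 := MemLp.integrable_norm_pow' (p := 2 * (n + 1)) (by exact_mod_cast h)
  refine h2.congr (Filter.Eventually.of_forall fun x => ?_)
  simp [pow_mul]

lemma dfact_lt (n : ℕ) : Nat.doubleFactorial (2 * n + 1) < 2 ^ (n + 1) * (n + 1).factorial := by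
  rw [← Nat.doubleFactorial_two_mul]
  induction n with
  | zero => decide
  | succ n ih =>
    rw [show 2 * (n + 1) + 1 = (2 * n + 1) + 2 by ring, show 2 * (n + 1 + 1) = 2 * (n + 1) + 2 by ring,
      Nat.doubleFactorial_add_two, Nat.doubleFactorial_add_two]
    exact Nat.mul_lt_mul_of_le_of_lt (by omega) ih (by omega)

lemma main_aux {K n : ℕ} (hK : 0 < K)
    (f : (Fin K → ℝ) → ℝ) (B σ : Fin K → ℝ) (H : ℝ)
    (hB : ∀ k, 0 < B k) (hσ : ∀ k, 0 < σ k) (hH : 0 < H)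
    (hf : ContDiff ℝ (⊤ : ℕ∞) f)
    (hBern : ∀ (α : Fin K → ℕ) (y : Fin K → ℝ),
      |mpderiv α f y| ≤ (∏ k, B k ^ α k) * H) (v : Fin K → NNReal)
    (hv : ∀ k, (v k : ℝ) = σ k ^ 2) :
    (∫ x : Fin K → ℝ, (f x - taylorPoly n f x) ^ 2
        ∂(Measure.pi fun k : Fin K => ProbabilityTheory.gaussianReal 0 (v k)))
      < (1 / K) * ∑ k : Fin K,
          ((Real.sqrt 2 * K * B k * σ k) ^ (n + 1) * H) ^ 2 / ((n + 1).factorial : ℝ) := by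
  set μ := Measure.pi fun k : Fin K => ProbabilityTheory.gaussianReal 0 (v k) with hμ
  have mp : ∀ k, MeasurePreserving (Function.eval k) μ (ProbabilityTheory.gaussianReal 0 (v k)) :=
    fun k => measurePreserving_eval _ k
  have hint : ∀ k, Integrable (fun x : Fin K → ℝ => x k ^ (2 * (n + 1))) μ := fun k =>
    (mp k).integrable_comp_of_integrable (gauss_int (v k) n)
  have hval : ∀ k, ∫ x : Fin K → ℝ, x k ^ (2 * (n + 1)) ∂μ
      = σ k ^ (2 * (n + 1)) * (Nat.doubleFactorial (2 * n + 1) : ℝ) := by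
    intro k
    rw [← gauss_moment (σ k) (hσ k) (v k) (hv k) n, ← (mp k).map_eq,
      integral_map (mp k).measurable.aemeasurable (by fun_prop)]
  set C : ℝ := (K : ℝ) ^ (2 * n + 1) * (H / (n + 1).factorial) ^ 2 with hC
  have hK' : (0 : ℝ) < K := by exact_mod_cast hK
  have hfac : (0 : ℝ) < (n + 1).factorial := by exact_mod_cast Nat.factorial_pos _
  have hpt : ∀ x : Fin K → ℝ, (f x - taylorPoly n f x) ^ 2 ≤
      ∑ k, C * B k ^ (2 * (n + 1)) * x k ^ (2 * (n + 1)) := by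
    intro x
    have h1 := pointwise_bound (n := n) f B H hf hBern x
    have h2 : (∑ k, B k * |x k|) ^ (2 * n + 1 + 1) ≤
        (K : ℝ) ^ (2 * n + 1) * ∑ k, (B k * |x k|) ^ (2 * n + 1 + 1) := by
      simpa using pow_sum_le_card_mul_sum_pow (s := Finset.univ) (f := fun k => B k * |x k|)
        (fun k _ => mul_nonneg (hB k).le (abs_nonneg _)) (2 * n + 1)
    calc (f x - taylorPoly n f x) ^ 2 = |f x - taylorPoly n f x| ^ 2 := (sq_abs _).symm
      _ ≤ ((∑ k, B k * |x k|) ^ (n + 1) * H / (n + 1).factorial) ^ 2 := by gcongr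
      _ = (∑ k, B k * |x k|) ^ (2 * n + 1 + 1) * (H / (n + 1).factorial) ^ 2 := by ring
      _ ≤ ((K : ℝ) ^ (2 * n + 1) * ∑ k, (B k * |x k|) ^ (2 * n + 1 + 1)) *
          (H / (n + 1).factorial) ^ 2 := by gcongr
      _ = _ := by
        rw [Finset.mul_sum, Finset.sum_mul]
        refine Finset.sum_congr rfl fun k _ => ?_
        rw [mul_pow, show 2 * n + 1 + 1 = 2 * (n + 1) by ring, pow_mul |x k|, sq_abs, ← pow_mul, hC]
        ring
  have hint2 : ∀ k ∈ (Finset.univ : Finset (Fin K)), Integrable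
      (fun x : Fin K → ℝ => C * B k ^ (2 * (n + 1)) * x k ^ (2 * (n + 1))) μ :=
    fun k _ => (hint k).const_mul _
  calc _ ≤ ∫ x, ∑ k, C * B k ^ (2 * (n + 1)) * x k ^ (2 * (n + 1)) ∂μ :=
        integral_mono_of_nonneg (Filter.Eventually.of_forall fun x => sq_nonneg _)
          (integrable_finsetSum _ hint2) (Filter.Eventually.of_forall hpt)
    _ = ∑ k, C * B k ^ (2 * (n + 1)) * (σ k ^ (2 * (n + 1)) *
          (Nat.doubleFactorial (2 * n + 1) : ℝ)) := by
        rw [integral_finsetSum _ hint2]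
        refine Finset.sum_congr rfl fun k _ => ?_
        rw [integral_const_mul, hval]
    _ < ∑ k, C * B k ^ (2 * (n + 1)) * (σ k ^ (2 * (n + 1)) *
          (2 ^ (n + 1) * (n + 1).factorial)) := by
        refine Finset.sum_lt_sum_of_nonempty ⟨⟨0, hK⟩, Finset.mem_univ _⟩ fun k _ => ?_
        have h1 := hB k
        have h2 := hσ k
        have h3 : (Nat.doubleFactorial (2 * n + 1) : ℝ) < 2 ^ (n + 1) * (n + 1).factorial := by
          exact_mod_cast dfact_lt n
        gcongr
    _ = _ := by
        rw [Finset.mul_sum]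
        refine Finset.sum_congr rfl fun k _ => ?_
        have e : ((Real.sqrt 2 * K * B k * σ k) ^ (n + 1) * H) ^ 2 =
            2 ^ (n + 1) * (K : ℝ) ^ (2 * (n + 1)) * B k ^ (2 * (n + 1)) * σ k ^ (2 * (n + 1)) * H ^ 2 := by
          rw [mul_pow, ← pow_mul, mul_comm (n + 1) 2, mul_pow, mul_pow, mul_pow, pow_mul (Real.sqrt 2),
            Real.sq_sqrt (by norm_num)]
        rw [e, hC]
        field_simp
        ring

/-- **Corollary 2.**  If `f : ℝ^K → ℝ` is smooth and satisfies the anisotropic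
Bernstein bound `|∂^α f(y)| ≤ (Π_k B_k^{α_k}) H` for every multi-index `α` and
every `y`, and the coordinates of `x` are independent Gaussians of mean `0` and
variances `σ_k²`, then
`E[|f(x) − T_n f(x)|²] < (1/K) Σ_k ((√2 K B_k σ_k)^{n+1} H)² / (n+1)!`. -/
theorem mean_expected_risk_bound_gaussian_diagonal {K n : ℕ} (hK : 0 < K)
    (f : (Fin K → ℝ) → ℝ) (B σ : Fin K → ℝ) (H : ℝ)
    (hB : ∀ k, 0 < B k) (hσ : ∀ k, 0 < σ k) (hH : 0 < H)
    (hf : ContDiff ℝ (⊤ : ℕ∞) f)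
    (hBern : ∀ (α : Fin K → ℕ) (y : Fin K → ℝ),
      |mpderiv α f y| ≤ (∏ k, B k ^ α k) * H) :
    (∫ x : Fin K → ℝ, (f x - taylorPoly n f x) ^ 2
        ∂(Measure.pi fun k : Fin K =>
          ProbabilityTheory.gaussianReal 0 ⟨σ k ^ 2, sq_nonneg (σ k)⟩))
      < (1 / K) * ∑ k : Fin K,
          ((Real.sqrt 2 * K * B k * σ k) ^ (n + 1) * H) ^ 2 / ((n + 1).factorial : ℝ) := by
  exact main_aux hK f B σ H hB hσ hH hf hBern _ (fun _ => rfl)
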